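/- arXiv:2511.07597 — 2 statements merged into one kernel-verified Lean document; each statement's English description precedes it below -/
import Mathlib

section
/- Let G be a finite group which is the product of k normal subgroups A₁,…,A_k such that pr(A_i, A_j) ≥ ε for all i,j. Then G has a normal subgroup D of (ε,k)-bounded index such that the commutator subgroup D′ has (ε,k)-bounded order. -/
/-- Commuting probability of two subgroups of a group. -/
noncomputable def subgroupCommProb {G : Type*} [Group G] (H K : Subgroup G) : ℚ :=
  (Nat.card {p : H × K // ((p.1 : G) * (p.2 : G) = (p.2 : G) * (p.1 : G))} : ℚ) /
    ((Nat.card H : ℚ) * (Nat.card K : ℚ))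

section ConjOrbit

open scoped Pointwise commutatorElement

variable {G : Type*} [Group G]

/-- The set of conjugates of `x` by the elements of the subgroup `K`. -/
def conjOrbit (K : Subgroup G) (x : G) : Set G :=
  (fun g => g * x * g⁻¹) '' (K : Set G)

theorem mem_conjOrbit {K : Subgroup G} {x y : G} :
    y ∈ conjOrbit K x ↔ ∃ g ∈ K, g * x * g⁻¹ = y := Iff.rfl

theorem conj_mem_conjOrbit {K : Subgroup G} {g : G} (hg : g ∈ K) (x : G) :
    g * x * g⁻¹ ∈ conjOrbit K x := ⟨g, hg, rfl⟩

theorem relIndex_centralizer_singleton (K : Subgroup G) (x : G) :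
    (Subgroup.centralizer {x}).relIndex K = (conjOrbit K x).ncard := by
  let : MulAction K G :=
    MulAction.compHom G ((ConjAct.toConjAct (G := G)).toMonoidHom.comp K.subtype)
  have hsmul (k : K) (y : G) : k • y = (k : G) * y * (k : G)⁻¹ := rfl
  have h1 : (Subgroup.centralizer {x}).subgroupOf K = MulAction.stabilizer K x := by
    ext k
    rw [Subgroup.mem_subgroupOf, Subgroup.mem_centralizer_singleton_iff,
      MulAction.mem_stabilizer_iff, hsmul, mul_inv_eq_iff_eq_mul]
  have h2 : conjOrbit K x = MulAction.orbit K x := by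
    ext y
    simp [mem_conjOrbit, MulAction.mem_orbit_iff, hsmul]
  rw [Subgroup.relIndex, h1, h2, MulAction.index_stabilizer]

theorem ncard_conjOrbit_one_le (K : Subgroup G) : (conjOrbit K (1 : G)).ncard ≤ 1 := by
  have : conjOrbit K (1 : G) ⊆ {1} := by
    rintro _ ⟨g, -, rfl⟩
    simp
  simpa using Set.ncard_le_ncard this

theorem ncard_conjOrbit_inv (K : Subgroup G) (x : G) :
    (conjOrbit K x⁻¹).ncard = (conjOrbit K x).ncard := by
  rw [← relIndex_centralizer_singleton, ← relIndex_centralizer_singleton]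
  congr 1
  ext g
  simp only [Subgroup.mem_centralizer_singleton_iff]
  exact Commute.inv_right_iff (a := g) (b := x)

theorem ncard_conjOrbit_conj (K : Subgroup G) [K.Normal] (x g : G) :
    (conjOrbit K (g * x * g⁻¹)).ncard = (conjOrbit K x).ncard := by
  have : conjOrbit K (g * x * g⁻¹) = (fun y => g * y * g⁻¹) '' conjOrbit K x := by
    ext y
    simp only [conjOrbit, Set.image_image]
    constructor
    · rintro ⟨k, hk, rfl⟩
      refine ⟨g⁻¹ * k * g, ?_, by group⟩
      simpa using ‹K.Normal›.conj_mem k hk g⁻¹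
    · rintro ⟨k, hk, rfl⟩
      exact ⟨g * k * g⁻¹, ‹K.Normal›.conj_mem k hk g, by group⟩
  rw [this]
  exact Set.ncard_image_of_injective _ (MulAut.conj g).injective

theorem ncard_biUnion_le_mul {α β : Type*} [Finite β] {s : Set α} (hs : s.Finite)
    (f : α → Set β) {n : ℕ} (h : ∀ a ∈ s, (f a).ncard ≤ n) :
    (⋃ a ∈ s, f a).ncard ≤ s.ncard * n := by
  classical
  have := Fintype.ofFinite β
  have key := Finset.card_biUnion_le_card_mul hs.toFinset (fun a => (f a).toFinset) n
    fun a ha => by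
      rw [← Set.ncard_eq_toFinset_card']
      exact h a (by simpa using ha)
  rw [← Set.ncard_eq_toFinset_card s hs] at key
  refine le_trans (le_of_eq ?_) key
  rw [← Set.ncard_coe_finset]
  congr 1
  ext
  simp

theorem ncard_conjOrbit_mono [Finite G] {K L : Subgroup G} (h : K ≤ L) (x : G) :
    (conjOrbit K x).ncard ≤ (conjOrbit L x).ncard :=
  Set.ncard_le_ncard (Set.image_mono h)

theorem ncard_mul_le [Finite G] (s t : Set G) : (s * t).ncard ≤ s.ncard * t.ncard := by
  simpa [Nat.card_coe_set_eq] using Set.natCard_mul_le (s := s) (t := t)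

theorem ncard_conjOrbit_mul_le [Finite G] (K : Subgroup G) (x y : G) :
    (conjOrbit K (x * y)).ncard ≤ (conjOrbit K x).ncard * (conjOrbit K y).ncard := by
  refine le_trans (Set.ncard_le_ncard ?_) (ncard_mul_le _ _)
  rintro _ ⟨g, hg, rfl⟩
  exact Set.mem_mul.2
    ⟨_, conj_mem_conjOrbit hg x, _, conj_mem_conjOrbit hg y, by group⟩

theorem ncard_conjOrbit_iSup_le [Finite G] {ι : Type*} (A : ι → Subgroup G)
    [∀ i, (A i).Normal] (X : Subgroup G) [X.Normal] {M : ℕ}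
    (h : ∀ i, ∀ x ∈ X, (conjOrbit (A i) x).ncard ≤ M) (s : Finset ι) :
    ∀ x ∈ X, (conjOrbit (⨆ i ∈ s, A i) x).ncard ≤ M ^ s.card := by
  classical
  induction s using Finset.induction_on with
  | empty =>
    intro x _
    simp [conjOrbit]
  | insert i s his ih =>
    intro x hx
    rw [Finset.iSup_insert, Finset.card_insert_of_notMem his, pow_succ]
    refine le_trans (Set.ncard_le_ncard (t := ⋃ y ∈ conjOrbit (⨆ j ∈ s, A j) x,
      conjOrbit (A i) y) ?_) ((ncard_biUnion_le_mul (Set.toFinite _) _ ?_).trans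
        (Nat.mul_le_mul_right M (ih x hx)))
    · rintro _ ⟨g, hg, rfl⟩
      obtain ⟨a, ha, b, hb, rfl⟩ := Subgroup.mem_sup_of_normal_left.1 hg
      exact Set.mem_biUnion (conj_mem_conjOrbit hb x)
        ⟨a, ha, by group⟩
    · rintro _ ⟨g, -, rfl⟩
      exact h i _ (‹X.Normal›.conj_mem x hx g)

theorem ncard_conjOrbit_le_of_mem_iSup [Finite G] {ι : Type*} (K : Subgroup G)
    (H : ι → Subgroup G) [∀ i, (H i).Normal] {M : ℕ}
    (h : ∀ i, ∀ x ∈ H i, (conjOrbit K x).ncard ≤ M) (s : Finset ι) :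
    ∀ x ∈ ⨆ i ∈ s, H i, (conjOrbit K x).ncard ≤ M ^ s.card := by
  classical
  induction s using Finset.induction_on with
  | empty =>
    intro x hx
    obtain rfl : x = 1 := by simpa using hx
    simpa using ncard_conjOrbit_one_le K
  | insert i s his ih =>
    intro x hx
    rw [Finset.iSup_insert] at hx
    obtain ⟨a, ha, b, hb, rfl⟩ := Subgroup.mem_sup_of_normal_left.1 hx
    rw [Finset.card_insert_of_notMem his, pow_succ']
    exact (ncard_conjOrbit_mul_le K a b).trans (Nat.mul_le_mul (h i a ha) (ih b hb))

theorem relIndex_iSup_le [Finite G] {ι : Type*} (A H : ι → Subgroup G)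
    [∀ i, (A i).Normal] [∀ i, (H i).Normal] {n : ℕ}
    (h : ∀ i, (H i).relIndex (A i) ≤ n) (hle : ∀ i, H i ≤ A i) (s : Finset ι) :
    (⨆ i ∈ s, H i).relIndex (⨆ i ∈ s, A i) ≤ n ^ s.card := by
  classical
  have key (B K L : Subgroup G) [B.Normal] [K.Normal] (hKL : K ≤ L) :
      (B ⊔ K).relIndex (B ⊔ L) ≤ K.relIndex L := by
    have : B ⊔ L = L ⊔ (B ⊔ K) := by
      rw [sup_comm B K, ← sup_assoc, sup_eq_left.2 hKL, sup_comm]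
    rw [this, Subgroup.relIndex_sup_right]
    exact Subgroup.relIndex_le_of_le_left le_sup_right Subgroup.index_ne_zero_of_finite
  induction s using Finset.induction_on with
  | empty => simp
  | insert i s his ih =>
    rw [Finset.iSup_insert, Finset.iSup_insert, Finset.card_insert_of_notMem his, pow_succ]
    set P := ⨆ i ∈ s, H i
    set Q := ⨆ i ∈ s, A i
    have hPQ : P ≤ Q := iSup₂_mono fun i _ => hle i
    have hQ : Q.Normal := inferInstance
    have hP : P.Normal := inferInstance
    rw [← Subgroup.relIndex_mul_relIndex (H i ⊔ P) (H i ⊔ Q) (A i ⊔ Q)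
      (sup_le_sup_left hPQ _) (sup_le_sup_right (hle i) _)]
    refine Nat.mul_le_mul ((key (H i) P Q hPQ).trans ih) ?_
    rw [sup_comm (H i), sup_comm (A i)]
    exact (key Q (H i) (A i) (hle i)).trans (h i)

/-- In a group all of whose conjugacy classes have at most `m` elements, the number of
commutators is bounded in terms of `m`. -/
theorem ncard_commutatorSet_le [Finite G] {m : ℕ}
    (h : ∀ x : G, (conjOrbit ⊤ x).ncard ≤ m) :
    (commutatorSet G).ncard ≤ m * m * (m ^ m * m * m) := by
  classical
  obtain ⟨a, ha⟩ := Finite.exists_max fun x : G => (conjOrbit ⊤ x).ncard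
  have hm : 1 ≤ m := by
    refine le_trans ?_ (h 1)
    exact (Set.ncard_pos (Set.toFinite _)).2 ⟨_, conj_mem_conjOrbit (Subgroup.mem_top 1) 1⟩
  choose b hb using fun y : conjOrbit (⊤ : Subgroup G) a => y.2
  have := Fintype.ofFinite (conjOrbit (⊤ : Subgroup G) a)
  set U : Subgroup G := ⨅ y, Subgroup.centralizer {b y}
  have hUindex : U.index ≤ m ^ m := by
    refine (Subgroup.index_iInf_le _).trans ?_
    refine (Finset.prod_le_pow_card _ _ m fun y _ => ?_).trans ?_
    · rw [← Subgroup.relIndex_top_right, relIndex_centralizer_singleton]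
      exact h _
    · refine Nat.pow_le_pow_right hm ?_
      rw [Finset.card_univ, ← Nat.card_eq_fintype_card, Nat.card_coe_set_eq]
      exact h a
  have hUcomm (u : G) (hu : u ∈ U) (g : G) :
      ⁅g, u⁆ ∈ (conjOrbit ⊤ a)⁻¹ * conjOrbit ⊤ a := by
    have hsub : (fun y => y * u) '' conjOrbit ⊤ a ⊆ conjOrbit ⊤ (a * u) := by
      rintro _ ⟨y, hy, rfl⟩
      refine ⟨b ⟨y, hy⟩, Subgroup.mem_top _, ?_⟩
      have h1 : b ⟨y, hy⟩ * a * (b ⟨y, hy⟩)⁻¹ = y := (hb ⟨y, hy⟩).2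
      have h2 : u * b ⟨y, hy⟩ = b ⟨y, hy⟩ * u :=
        Subgroup.mem_centralizer_singleton_iff.1 (Subgroup.mem_iInf.1 hu ⟨y, hy⟩)
      have h3 : b ⟨y, hy⟩ * u * (b ⟨y, hy⟩)⁻¹ = u := by rw [← h2, mul_inv_cancel_right]
      calc b ⟨y, hy⟩ * (a * u) * (b ⟨y, hy⟩)⁻¹
          = (b ⟨y, hy⟩ * a * (b ⟨y, hy⟩)⁻¹) * (b ⟨y, hy⟩ * u * (b ⟨y, hy⟩)⁻¹) := by group
        _ = y * u := by rw [h1, h3]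
    have heq := Set.eq_of_subset_of_ncard_le hsub
      (by rw [Set.ncard_image_of_injective _ (mul_left_injective u)]; exact ha (a * u))
    obtain ⟨y, hy, hyu⟩ : g * (a * u) * g⁻¹ ∈ (fun y => y * u) '' conjOrbit ⊤ a := by
      rw [heq]
      exact conj_mem_conjOrbit (Subgroup.mem_top g) _
    refine Set.mem_mul.2 ⟨(g * a * g⁻¹)⁻¹,
      Set.inv_mem_inv.2 (conj_mem_conjOrbit (Subgroup.mem_top g) a), y, hy, ?_⟩
    have : y = g * (a * u) * g⁻¹ * u⁻¹ := eq_mul_inv_of_mul_eq hyu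
    rw [this, commutatorElement_def]
    group
  set R : Set G := Set.range fun q : G ⧸ U => q.out⁻¹
  have hR : R.ncard ≤ m ^ m := by
    refine le_trans ?_ hUindex
    rw [Subgroup.index, ← Nat.card_coe_set_eq]
    exact Finite.card_range_le _
  set T : Set G := ⋃ r ∈ R, ⋃ z ∈ conjOrbit ⊤ r, conjOrbit ⊤ (z * r⁻¹)
  have hT : T.ncard ≤ m ^ m * m * m := by
    rw [mul_assoc]
    refine (ncard_biUnion_le_mul (n := m * m) (Set.toFinite _) _ fun r _ => ?_).trans
      (Nat.mul_le_mul_right _ hR)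
    exact (ncard_biUnion_le_mul (n := m) (Set.toFinite _) _ fun z _ => h _).trans
      (Nat.mul_le_mul_right _ (h r))
  have hsub : commutatorSet G ⊆ (conjOrbit ⊤ a)⁻¹ * conjOrbit ⊤ a * T := by
    rintro _ ⟨g, x, rfl⟩
    obtain ⟨u, hu⟩ := QuotientGroup.mk_out_eq_mul U x⁻¹
    set r := ((x⁻¹ : G) : G ⧸ U).out⁻¹ with hr
    have hx : x = u * r := by rw [hr, hu]; group
    refine Set.mem_mul.2 ⟨⁅g, (u : G)⁆, hUcomm u u.2 g, u * (g * r * g⁻¹ * r⁻¹) * (u : G)⁻¹, ?_, ?_⟩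
    · refine Set.mem_biUnion ⟨_, rfl⟩ (Set.mem_biUnion
        (conj_mem_conjOrbit (Subgroup.mem_top g) r) (conj_mem_conjOrbit (Subgroup.mem_top _) _))
    · rw [hx]
      simp only [commutatorElement_def]
      group
  refine (Set.ncard_le_ncard hsub).trans ((ncard_mul_le _ _).trans (Nat.mul_le_mul ?_ hT))
  refine (ncard_mul_le _ _).trans (Nat.mul_le_mul ?_ (h a))
  rw [← Nat.card_coe_set_eq, Set.natCard_inv]
  exact h a

/-- An increasing sequence of symmetric sets with `X t * X t ⊆ X (t + 1)` stabilises within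
a number of steps depending only on the density of `X 0`. -/
theorem exists_eq_succ_of_card_le [Finite G] (H : Subgroup G) (X : ℕ → Set G)
    (hXH : ∀ t, X t ⊆ H) (hone : 1 ∈ X 0) (hmono : Monotone X)
    (hinv : ∀ t, ∀ x ∈ X t, x⁻¹ ∈ X t)
    (hmul : ∀ t, ∀ x ∈ X t, ∀ y ∈ X t, x * y ∈ X (t + 1)) {n : ℕ}
    (hcard : Nat.card H ≤ n * (X 0).ncard) :
    ∃ t ≤ 3 * n, X (t + 1) = X t := by
  by_contra! hne
  have key : ∀ i ≤ n, (i + 1) * (X 0).ncard ≤ (X (3 * i)).ncard := by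
    intro i
    induction i with
    | zero => simp
    | succ i ih =>
      intro hi
      obtain ⟨x, hx, hx'⟩ := Set.exists_of_ssubset
        ((hmono (Nat.le_succ (3 * i + 1))).ssubset_of_ne (hne (3 * i + 1) (by omega)).symm)
      have hdisj : Disjoint (X (3 * i)) ((fun y => x * y) '' X 0) := by
        rw [Set.disjoint_left]
        rintro _ hy ⟨s, hs, rfl⟩
        refine hx' ?_
        simpa using hmul _ _ hy _ (hinv _ _ (hmono (Nat.zero_le (3 * i)) hs))
      have hsub : X (3 * i) ∪ (fun y => x * y) '' X 0 ⊆ X (3 * (i + 1)) := by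
        refine Set.union_subset (hmono (by omega)) ?_
        rintro _ ⟨s, hs, rfl⟩
        exact hmul (3 * i + 1 + 1) _ hx _ (hmono (Nat.zero_le _) hs)
      have hle := Set.ncard_le_ncard hsub
      rw [Set.ncard_union_eq hdisj,
        Set.ncard_image_of_injective _ (mul_right_injective x)] at hle
      have := ih (by omega)
      linarith
  have h1 := key n le_rfl
  have h2 : (X (3 * n)).ncard ≤ Nat.card H := by
    rw [← SetLike.coe_sort_coe, Nat.card_coe_set_eq]
    exact Set.ncard_le_ncard (hXH _)
  have h3 : 0 < (X 0).ncard := (Set.ncard_pos (Set.toFinite _)).2 ⟨1, hone⟩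
  linarith

/-- If `pr(H, K) ≥ ε`, a proportion of at least `ε / 2` of the elements of `H` has at most
`2 / ε` conjugates under `K`. -/
theorem card_le_mul_ncard_of_le_subgroupCommProb [Finite G] {ε : ℚ} (hε : 0 < ε)
    (H K : Subgroup G) (h : ε ≤ subgroupCommProb H K) :
    Nat.card H ≤ ⌈2 / ε⌉₊ * {x ∈ (H : Set G) | (conjOrbit K x).ncard ≤ ⌈2 / ε⌉₊}.ncard := by
  classical
  have := Fintype.ofFinite G
  have := Fintype.ofFinite H
  set n := ⌈2 / ε⌉₊
  set S := {x ∈ (H : Set G) | (conjOrbit K x).ncard ≤ n}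
  have hn : 2 ≤ ε * n := by
    have := Nat.le_ceil (2 / ε)
    rwa [div_le_iff₀' hε] at this
  have hnpos : (0 : ℚ) < n := by
    by_contra! h0
    nlinarith
  have hK : (0 : ℚ) < Nat.card K := by exact_mod_cast Nat.card_pos
  have hH : (0 : ℚ) < Nat.card H := by exact_mod_cast Nat.card_pos
  let c : H → ℕ := fun x => Nat.card ((Subgroup.centralizer {(x : G)}).subgroupOf K)
  have hc (x : H) : c x * (conjOrbit K (x : G)).ncard = Nat.card K := by
    rw [← relIndex_centralizer_singleton]
    exact Subgroup.card_mul_index _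
  have hpairs : Nat.card {p : H × K // ((p.1 : G) * (p.2 : G) = (p.2 : G) * (p.1 : G))}
      = ∑ x : H, c x := by
    rw [← Nat.card_sigma]
    refine Nat.card_congr
      { toFun := fun p => ⟨p.1.1, p.1.2, ?_⟩
        invFun := fun p => ⟨(p.1, p.2.1), ?_⟩
        left_inv := fun _ => rfl
        right_inv := fun _ => rfl }
    · rw [Subgroup.mem_subgroupOf, Subgroup.mem_centralizer_singleton_iff]
      exact p.2.symm
    · have := p.2.2
      rw [Subgroup.mem_subgroupOf, Subgroup.mem_centralizer_singleton_iff] at this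
      exact this.symm
  have hcle (x : H) :
      (c x : ℚ) ≤ (if (x : G) ∈ S then (Nat.card K : ℚ) else 0) + Nat.card K / n := by
    have hcx : (c x : ℚ) * (conjOrbit K (x : G)).ncard = Nat.card K := by exact_mod_cast hc x
    split_ifs with hx
    · have : (c x : ℚ) ≤ Nat.card K := by
        exact_mod_cast Subgroup.card_le_card_group _
      have : (0 : ℚ) ≤ Nat.card K / n := by positivity
      linarith
    · have hlt : n ≤ (conjOrbit K (x : G)).ncard := by
        by_contra! hcon
        exact hx ⟨x.2, hcon.le⟩
      rw [zero_add, le_div_iff₀ hnpos, ← hcx]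
      gcongr
  have hScard : (Finset.univ.filter fun x : H => (x : G) ∈ S).card = S.ncard := by
    rw [← Set.ncard_coe_finset, ← Set.ncard_image_of_injective _ Subtype.val_injective]
    congr 1
    ext x
    simp only [Set.mem_image, Finset.coe_filter, Finset.mem_univ, true_and, Set.mem_ofPred_eq]
    exact ⟨fun ⟨y, hy, h⟩ => h ▸ hy, fun hx => ⟨⟨x, hx.1⟩, hx, rfl⟩⟩
  have hsum : ((∑ x : H, c x : ℕ) : ℚ) ≤ S.ncard * Nat.card K + Nat.card H * (Nat.card K / n) := by
    push_cast
    refine (Finset.sum_le_sum fun x _ => hcle x).trans (le_of_eq ?_)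
    rw [Finset.sum_add_distrib, ← Finset.sum_filter, Finset.sum_const, Finset.sum_const, hScard,
      Finset.card_univ, Nat.card_eq_fintype_card (α := H), nsmul_eq_mul, nsmul_eq_mul]
  rw [subgroupCommProb, hpairs, le_div_iff₀ (by positivity)] at h
  have h1 : ε * Nat.card H ≤ S.ncard + Nat.card H / n := by
    have : (ε * Nat.card H) * Nat.card K ≤ (S.ncard + Nat.card H / n : ℚ) * Nat.card K := by
      calc _ = ε * (Nat.card H * Nat.card K) := by ring
        _ ≤ _ := h.trans hsum
        _ = _ := by ring
    exact le_of_mul_le_mul_right this hK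
  have h2 : ε * n * Nat.card H ≤ n * S.ncard + Nat.card H := by
    calc ε * n * Nat.card H = n * (ε * Nat.card H) := by ring
      _ ≤ n * (S.ncard + Nat.card H / n : ℚ) := by gcongr
      _ = _ := by field_simp
  have h3 : (Nat.card H : ℚ) ≤ n * S.ncard := by nlinarith
  exact_mod_cast h3

/-- If `pr(H, K) ≥ ε` for normal subgroups `H` and `K`, there is a normal subgroup of `ε`-bounded
index in `H` whose elements have `ε`-boundedly many conjugates under `K`. -/
theorem exists_normal_relIndex_le_of_le_subgroupCommProb [Finite G] {ε : ℚ} (hε : 0 < ε)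
    (H K : Subgroup G) [H.Normal] [K.Normal] (h : ε ≤ subgroupCommProb H K) :
    ∃ L : Subgroup G, L.Normal ∧ L ≤ H ∧ L.relIndex H ≤ ⌈2 / ε⌉₊ ∧
      ∀ x ∈ L, (conjOrbit K x).ncard ≤ ⌈2 / ε⌉₊ ^ 2 ^ (3 * ⌈2 / ε⌉₊) := by
  have hcard := card_le_mul_ncard_of_le_subgroupCommProb hε H K h
  set n := ⌈2 / ε⌉₊
  have hn : 1 ≤ n := Nat.one_le_iff_ne_zero.2 (Nat.ceil_pos.2 (by positivity)).ne'
  let X : ℕ → Set G := fun t => {x ∈ (H : Set G) | (conjOrbit K x).ncard ≤ n ^ 2 ^ t}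
  have hone (t : ℕ) : 1 ∈ X t :=
    ⟨H.one_mem, (ncard_conjOrbit_one_le K).trans (Nat.one_le_pow _ _ hn)⟩
  have hmono : Monotone X := fun s t hst x hx =>
    ⟨hx.1, hx.2.trans (Nat.pow_le_pow_right hn (Nat.pow_le_pow_right two_pos hst))⟩
  have hinv (t : ℕ) (x : G) (hx : x ∈ X t) : x⁻¹ ∈ X t :=
    ⟨H.inv_mem hx.1, (ncard_conjOrbit_inv K x).trans_le hx.2⟩
  have hmul (t : ℕ) (x : G) (hx : x ∈ X t) (y : G) (hy : y ∈ X t) : x * y ∈ X (t + 1) := by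
    refine ⟨H.mul_mem hx.1 hy.1, (ncard_conjOrbit_mul_le K x y).trans ?_⟩
    rw [pow_succ, pow_mul, sq]
    exact Nat.mul_le_mul hx.2 hy.2
  have hcard' : Nat.card H ≤ n * (X 0).ncard := by simpa [X] using hcard
  obtain ⟨t, ht, hstab⟩ := exists_eq_succ_of_card_le H X (fun _ _ hx => hx.1) (hone 0) hmono
    hinv hmul hcard'
  let L : Subgroup G :=
    { carrier := X t
      one_mem' := hone t
      mul_mem' := fun {x y} hx hy => hstab ▸ hmul t x hx y hy
      inv_mem' := fun {x} hx => hinv t x hx }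
  have hLH : L ≤ H := fun x hx => hx.1
  refine ⟨L, ⟨fun x hx g => ⟨‹H.Normal›.conj_mem x hx.1 g, ?_⟩⟩, hLH, ?_, fun x hx => ?_⟩
  · exact (ncard_conjOrbit_conj K x g).trans_le hx.2
  · have hL : (X 0).ncard ≤ Nat.card L := by
      rw [← SetLike.coe_sort_coe, Nat.card_coe_set_eq]
      exact Set.ncard_le_ncard (hmono (Nat.zero_le t))
    have hmulindex : Nat.card L * L.relIndex H = Nat.card H := by
      rw [← Subgroup.relIndex_bot_left, ← Subgroup.relIndex_bot_left,
        Subgroup.relIndex_mul_relIndex _ _ _ bot_le hLH]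
    refine le_of_mul_le_mul_left ?_ (Nat.card_pos (α := L))
    rw [hmulindex, mul_comm]
    exact hcard'.trans (Nat.mul_le_mul_left n hL)
  · exact (hmono ht hx).2

/-- If the elements of a subgroup `D` have boundedly many conjugates, then the derived subgroup
of `D` has bounded order. -/
theorem card_commutator_le_of_ncard_conjOrbit_le [Finite G] (D : Subgroup G) {m : ℕ}
    (h : ∀ x ∈ D, (conjOrbit ⊤ x).ncard ≤ m) :
    Nat.card (⁅D, D⁆ : Subgroup G) ≤
      ∑ i ∈ Finset.range (m * m * (m ^ m * m * m) + 1), Subgroup.cardCommutatorBound i := by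
  have hD (x : D) : (conjOrbit (⊤ : Subgroup D) x).ncard ≤ m := by
    refine le_trans ?_ (h x x.2)
    rw [← Set.ncard_image_of_injective _ D.subtype_injective]
    refine Set.ncard_le_ncard ?_
    rintro _ ⟨_, ⟨g, -, rfl⟩, rfl⟩
    exact ⟨g, Subgroup.mem_top _, rfl⟩
  have hcomm := ncard_commutatorSet_le hD
  rw [← Nat.card_coe_set_eq] at hcomm
  rw [← D.map_subtype_commutator, Subgroup.card_map_of_injective D.subtype_injective]
  refine (Subgroup.card_commutator_le_of_finite_commutatorSet D).trans ?_
  exact Finset.single_le_sum (f := Subgroup.cardCommutatorBound) (fun _ _ => Nat.zero_le _)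
    (Finset.mem_range.2 (Nat.lt_succ_of_le hcomm))

end ConjOrbit

/-- If a finite group `G` is the product of `k` normal subgroups
`A₁,…,A_k` with `pr(A_i,A_j) ≥ ε` for all `i,j`, then `G` has a normal subgroup `D`
of `(ε,k)`-bounded index whose derived subgroup `D'` has `(ε,k)`-bounded order. -/
theorem stmt_13 (ε : ℚ) (hε : 0 < ε) (k : ℕ) :
    ∃ C : ℕ, ∀ (G : Type) (_ : Group G) (_ : Finite G) (A : Fin k → Subgroup G),
      (∀ i, (A i).Normal) → (⨆ i, A i) = ⊤ →
      (∀ i j, subgroupCommProb (A i) (A j) ≥ ε) →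
      ∃ D : Subgroup G, D.Normal ∧ D.index ≤ C ∧ Nat.card (⁅D, D⁆ : Subgroup G) ≤ C := by
  set n := ⌈2 / ε⌉₊
  set m := ((n ^ 2 ^ (3 * n)) ^ k) ^ k
  refine ⟨(n ^ k) ^ k + ∑ i ∈ Finset.range (m * m * (m ^ m * m * m) + 1),
    Subgroup.cardCommutatorBound i, ?_⟩
  intro G _ _ A hA hsup hpr
  choose L hLn hLA hLi hL using fun i j =>
    exists_normal_relIndex_le_of_le_subgroupCommProb hε (A i) (A j) (hpr i j)
  let H : Fin k → Subgroup G := fun i => ⨅ j, L i j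
  have hHn (i : Fin k) : (H i).Normal := Subgroup.normal_iInf_normal (hLn i)
  have hHA (i : Fin k) : H i ≤ A i := (iInf_le _ i).trans (hLA i i)
  have hHi (i : Fin k) : (H i).relIndex (A i) ≤ n ^ k := by
    refine (Subgroup.relIndex_iInf_le _).trans ?_
    simpa using Finset.prod_le_pow_card Finset.univ _ n fun j _ => hLi i j
  have hH (i : Fin k) (x : G) (hx : x ∈ H i) :
      (conjOrbit ⊤ x).ncard ≤ (n ^ 2 ^ (3 * n)) ^ k := by
    simpa [hsup] using ncard_conjOrbit_iSup_le A (H i)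
      (fun j x hx => hL i j x (Subgroup.mem_iInf.1 hx j)) Finset.univ x hx
  refine ⟨⨆ i, H i, inferInstance, le_add_right ?_, le_add_left ?_⟩
  · simpa [hsup] using relIndex_iSup_le A H hHi hHA Finset.univ
  · refine card_commutator_le_of_ncard_conjOrbit_le _ fun x hx => ?_
    simpa using ncard_conjOrbit_le_of_mem_iSup ⊤ H hH Finset.univ x (by simpa using hx)
end

section
/- Let A be a finite group acting coprimely by automorphisms on a finite group G such that |[G,a]| ≤ m for every a ∈ A. Then |[G,A]| is bounded in terms of m alone. -/
/-- The subgroup `[G,a]` generated by all `g⁻¹ · (a • g)` for a single element `a`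
of a group acting on `G` by automorphisms. -/
def elemCommutator {A G : Type*} [Monoid A] [Group G] [MulDistribMulAction A G]
    (a : A) : Subgroup G :=
  Subgroup.closure (Set.range fun g : G => g⁻¹ * a • g)

/-- The subgroup `[G,A]` generated by all `g⁻¹ · (a • g)`. -/
def actionCommutator (A : Type*) {G : Type*} [Monoid A] [Group G]
    [MulDistribMulAction A G] : Subgroup G :=
  Subgroup.closure {x : G | ∃ (g : G) (a : A), g⁻¹ * a • g = x}

open scoped Pointwise

namespace Subgroup

theorem index_le_card_of_fiber {G α : Type*} [Group G] [Finite α] {H : Subgroup G} (f : G → α)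
    (h : ∀ x y, f x = f y → x⁻¹ * y ∈ H) : H.index ≤ Nat.card α := by
  refine Nat.card_le_card_of_injective (fun q : G ⧸ H => f q.out) fun p q hpq => ?_
  rw [← p.out_eq', ← q.out_eq']
  exact QuotientGroup.eq.2 (h _ _ hpq)

theorem card_iSup_le_prod {ι G : Type*} [Group G] [Finite G] (s : Finset ι) (f : ι → Subgroup G)
    (hf : ∀ i, (f i).Normal) : Nat.card ↥(⨆ i ∈ s, f i) ≤ ∏ i ∈ s, Nat.card (f i) := by
  classical
  induction s using Finset.induction_on with
  | empty => simp
  | insert a s ha ih =>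
    rw [Finset.iSup_insert, Finset.prod_insert ha, sup_comm]
    have := hf a
    have h : Nat.card ↥((⨆ i ∈ s, f i) ⊔ f a) ≤ Nat.card ↥(⨆ i ∈ s, f i) * Nat.card (f a) := by
      have := Set.natCard_mul_le (s := ((⨆ i ∈ s, f i : Subgroup G) : Set G)) (t := (f a : Set G))
      rwa [← mul_normal] at this
    calc _ ≤ _ := h
      _ ≤ _ := by rw [mul_comm]; exact Nat.mul_le_mul_left _ ih

/-- In a finite group, an increasing chain of symmetric sets `X n` with `X n * X n ⊆ X (n + 1)`
and `X 0` of bounded index reaches a subgroup after boundedly many steps. -/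
theorem exists_coe_eq_of_mul_subset {G : Type*} [Group G] [Finite G] (X : ℕ → Set G)
    (hmono : Monotone X) (hone : 1 ∈ X 0) (hinv : ∀ n, ∀ x ∈ X n, x⁻¹ ∈ X n)
    (hmul : ∀ n, ∀ x ∈ X n, ∀ y ∈ X n, x * y ∈ X (n + 1)) (c : ℕ)
    (hc : Nat.card G ≤ c * (X 0).ncard) :
    ∃ n ≤ 3 * c + 1, ∃ H : Subgroup G, (H : Set G) = X n := by
  have key : ∃ k ≤ c, X (3 * k + 2) ⊆ X (3 * k + 1) := by
    by_contra! hne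
    have grow : ∀ k ≤ c + 1, (k + 1) * (X 0).ncard ≤ (X (3 * k)).ncard := by
      intro k
      induction k with
      | zero => simp
      | succ k ih =>
        intro hk
        obtain ⟨g, hg, hg'⟩ := Set.not_subset.1 (hne k (by omega))
        have hdisj : Disjoint (X (3 * k)) (g • X (3 * k)) := by
          rw [Set.disjoint_left]
          rintro _ hx ⟨y, hy, rfl⟩
          refine hg' ?_
          simpa using hmul _ _ hx _ (hinv _ _ hy)
        have hsub : X (3 * k) ∪ g • X (3 * k) ⊆ X (3 * (k + 1)) := by
          refine Set.union_subset (hmono (by omega)) ?_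
          rintro _ ⟨y, hy, rfl⟩
          exact hmul (3 * k + 2) _ hg _ (hmono (by omega) hy)
        have h1 := Set.ncard_le_ncard hsub (Set.toFinite _)
        rw [Set.ncard_union_eq hdisj (Set.toFinite _) (Set.toFinite _), Set.ncard_smul_set] at h1
        have h2 := Set.ncard_le_ncard (hmono (Nat.zero_le (3 * k))) (Set.toFinite _)
        have h3 := ih (by omega)
        linarith
    have h1 := grow c (by omega)
    have h2 : (X (3 * c)).ncard ≤ Nat.card G := Set.ncard_le_card _
    have h3 : 0 < (X 0).ncard := (Set.ncard_pos (Set.toFinite _)).2 ⟨1, hone⟩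
    linarith
  obtain ⟨k, hk, hX⟩ := key
  refine ⟨3 * k + 1, by omega,
    { carrier := X (3 * k + 1)
      one_mem' := hmono (Nat.zero_le _) hone
      mul_mem' := fun hx hy => hX (hmul _ _ hx _ hy)
      inv_mem' := fun hx => hinv _ _ hx }, rfl⟩

end Subgroup

section Action

variable {A G : Type*} [Group A] [Group G] [MulDistribMulAction A G]

/-- The subgroup of points fixed by a single element of the acting group. -/
def elemCentralizer (a : A) : Subgroup G :=
  (MulDistribMulAction.toMonoidHom G a).eqLocus (MonoidHom.id G)

@[simp]
theorem mem_elemCentralizer {a : A} {g : G} : g ∈ elemCentralizer a ↔ a • g = g := Iff.rfl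

theorem smul_eq_self_of_coprime (hco : (Nat.card A).Coprime (Nat.card G)) {a : A} {g w : G}
    (hg : a • g = g * w) (hw : a • w = w) : a • g = g := by
  have h : ∀ n : ℕ, a ^ n • g = g * w ^ n := by
    intro n
    induction n with
    | zero => simp
    | succ n ih => rw [pow_succ', mul_smul, ih, smul_mul', smul_pow', hg, hw, mul_assoc, pow_succ']
  have h1 : w ^ Nat.card A = 1 := by simpa using (h (Nat.card A)).symm
  have h2 : w = 1 := by
    rw [← orderOf_eq_one_iff]
    exact Nat.eq_one_of_dvd_coprimes hco (orderOf_dvd_of_pow_eq_one h1) (orderOf_dvd_natCard w)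
  rw [hg, h2, mul_one]

theorem inv_mul_smul_mem_elemCommutator (a : A) (g : G) : g⁻¹ * a • g ∈ elemCommutator (G := G) a :=
  Subgroup.subset_closure ⟨g, rfl⟩

theorem elemCommutator_normal (a : A) : (elemCommutator (G := G) a).Normal := by
  refine ⟨fun n hn h => ?_⟩
  suffices hle : elemCommutator (G := G) a ≤
      (elemCommutator (G := G) a).comap (MulAut.conj h).toMonoidHom from hle hn
  refine (Subgroup.closure_le _).2 ?_
  rintro _ ⟨g, rfl⟩
  have h1 := inv_mul_smul_mem_elemCommutator a (g * h⁻¹)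
  have h2 := inv_mul_smul_mem_elemCommutator a h⁻¹
  have h3 := mul_mem h1 (inv_mem h2)
  simp only [SetLike.mem_coe, Subgroup.mem_comap, MulEquiv.toMonoidHom_eq_coe,
    MonoidHom.coe_coe, MulAut.conj_apply]
  convert h3 using 1
  simp only [smul_mul']
  group

theorem index_elemCentralizer_le [Finite G] (a : A) :
    (elemCentralizer (G := G) a).index ≤ Nat.card (elemCommutator (G := G) a) := by
  refine Subgroup.index_le_card_of_fiber
    (fun g : G => ⟨g * (a • g)⁻¹, by simpa using inv_mul_smul_mem_elemCommutator a g⁻¹⟩) ?_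
  intro x y hxy
  have h : x * (a • x)⁻¹ = y * (a • y)⁻¹ := congrArg Subtype.val hxy
  rw [mem_elemCentralizer, smul_mul', smul_inv']
  calc (a • x)⁻¹ * a • y = x⁻¹ * (x * (a • x)⁻¹) * a • y := by group
    _ = x⁻¹ * y := by rw [h]; group

theorem mem_ker_toPermHom {a : A} :
    a ∈ (MulAction.toPermHom A G).ker ↔ ∀ g : G, a • g = g := by
  rw [MonoidHom.mem_ker, Equiv.ext_iff]
  rfl

theorem elemCommutator_eq_of_inv_mul_mem_ker {a b : A}
    (h : a⁻¹ * b ∈ (MulAction.toPermHom A G).ker) :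
    elemCommutator (G := G) a = elemCommutator b := by
  have hab : ∀ g : G, a • g = b • g := fun g => by
    have := mem_ker_toPermHom.1 h g
    rw [mul_smul, inv_smul_eq_iff] at this
    exact this.symm
  simp only [elemCommutator, hab]

theorem card_actionCommutator_le [Finite A] [Finite G] {m : ℕ}
    (hm : ∀ a : A, Nat.card (elemCommutator (G := G) a) ≤ m) :
    Nat.card (actionCommutator A (G := G)) ≤ m ^ (MulAction.toPermHom A G).ker.index := by
  classical
  set L := (MulAction.toPermHom A G).ker
  have := Fintype.ofFinite (A ⧸ L)
  have hle : actionCommutator A (G := G) ≤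
      ⨆ q ∈ (Finset.univ : Finset (A ⧸ L)), elemCommutator (G := G) q.out := by
    rw [actionCommutator, Subgroup.closure_le]
    rintro _ ⟨g, a, rfl⟩
    have h : elemCommutator (G := G) (a : A ⧸ L).out = elemCommutator a :=
      elemCommutator_eq_of_inv_mul_mem_ker (QuotientGroup.eq.1 (Quotient.out_eq' _))
    refine le_iSup₂ (f := fun (q : A ⧸ L) (_ : q ∈ Finset.univ) => elemCommutator (G := G) q.out)
      (a : A ⧸ L) (Finset.mem_univ _) ?_
    rw [h]
    exact inv_mul_smul_mem_elemCommutator a g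
  calc _ ≤ _ := Subgroup.card_le_of_le hle
    _ ≤ _ := Subgroup.card_iSup_le_prod _ _ fun q => elemCommutator_normal _
    _ ≤ ∏ q : A ⧸ L, m := Finset.prod_le_prod' fun q _ => hm _
    _ = _ := by rw [Finset.prod_const, Finset.card_univ, ← Nat.card_eq_fintype_card]; rfl

/-- A coprime group of automorphisms centralizing a subgroup of finite index has bounded order. -/
theorem index_ker_le_of_forall_smul_eq [Finite G] (hco : (Nat.card A).Coprime (Nat.card G))
    (C : Subgroup G) (hC : ∀ a : A, ∀ c ∈ C, a • c = c) :
    (MulAction.toPermHom A G).ker.index ≤ C.index ^ C.index := by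
  have hcard : Nat.card (G ⧸ C → G ⧸ C) = C.index ^ C.index := Nat.card_fun
  rw [← hcard]
  refine Subgroup.index_le_card_of_fiber
    (fun (a : A) (q : G ⧸ C) => ((a • q.out : G) : G ⧸ C)) fun a b hab => ?_
  rw [mem_ker_toPermHom]
  intro g
  set t := (g : G ⧸ C).out with ht
  have hmem : (a • t)⁻¹ * b • t ∈ C := QuotientGroup.eq.1 (congrFun hab (g : G ⧸ C))
  have hmul : (a⁻¹ * b) • t = t * ((a • t)⁻¹ * b • t) := by
    have h := hC a⁻¹ _ hmem
    rw [smul_mul', smul_inv', inv_smul_smul, ← mul_smul] at h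
    rw [← h, mul_inv_cancel_left]
  have hfix : (a⁻¹ * b) • t = t := smul_eq_self_of_coprime hco hmul (hC _ _ hmem)
  have hg : t⁻¹ * g ∈ C := QuotientGroup.eq.1 (Quotient.out_eq' (g : G ⧸ C))
  calc (a⁻¹ * b) • g = (a⁻¹ * b) • (t * (t⁻¹ * g)) := by rw [mul_inv_cancel_left]
    _ = g := by rw [smul_mul', hfix, hC _ _ hg, mul_inv_cancel_left]

theorem card_le_mul_ncard_index_stabilizer_le [Finite A] [Finite G] {m : ℕ}
    (hm : ∀ a : A, (elemCentralizer (G := G) a).index ≤ m) :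
    Nat.card G ≤ 2 * m * {g : G | (MulAction.stabilizer A g).index ≤ 2 * m}.ncard := by
  classical
  have := Fintype.ofFinite A
  have := Fintype.ofFinite G
  set X : Finset G := Finset.univ.filter fun g => (MulAction.stabilizer A g).index ≤ 2 * m with hX
  have hXc : {g : G | (MulAction.stabilizer A g).index ≤ 2 * m}.ncard = X.card := by
    rw [← Set.ncard_coe_finset, hX]; simp
  rw [hXc]
  have hdc : ∑ a : A, Nat.card (elemCentralizer (G := G) a) =
      ∑ g : G, Nat.card (MulAction.stabilizer A g) := by
    have h := Finset.sum_card_bipartiteAbove_eq_sum_card_bipartiteBelow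
      (s := (Finset.univ : Finset A)) (t := (Finset.univ : Finset G)) (fun a g => a • g = g)
    convert h using 2 with a _ g _
    · rw [Finset.bipartiteAbove, ← Fintype.card_subtype, ← Nat.card_eq_fintype_card]; rfl
    · rw [Finset.bipartiteBelow, ← Fintype.card_subtype, ← Nat.card_eq_fintype_card]; rfl
  have hlow : Nat.card A * Nat.card G ≤ m * ∑ a : A, Nat.card (elemCentralizer (G := G) a) := by
    rw [Finset.mul_sum, Nat.card_eq_fintype_card (α := A), ← Finset.card_univ, ← smul_eq_mul]
    refine Finset.card_nsmul_le_sum _ _ _ fun a _ => ?_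
    rw [← (elemCentralizer (G := G) a).index_mul_card]
    exact Nat.mul_le_mul_right _ (hm a)
  have hup : 2 * m * ∑ g : G, Nat.card (MulAction.stabilizer A g) ≤
      2 * m * (X.card * Nat.card A) + Nat.card G * Nat.card A := by
    have hpt : ∀ g : G, 2 * m * Nat.card (MulAction.stabilizer A g) ≤
        (if g ∈ X then 2 * m * Nat.card A else 0) + Nat.card A := by
      intro g
      split_ifs with hg
      · exact (Nat.mul_le_mul_left _ (Subgroup.card_le_card_group _)).trans (Nat.le_add_right _ _)
      · have hg' : 2 * m < (MulAction.stabilizer A g).index := by simpa [hX] using hg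
        rw [zero_add, ← (MulAction.stabilizer A g).index_mul_card]
        exact Nat.mul_le_mul_right _ hg'.le
    rw [Finset.mul_sum]
    refine (Finset.sum_le_sum fun g _ => hpt g).trans (le_of_eq ?_)
    rw [Finset.sum_add_distrib, Finset.sum_ite_mem, Finset.univ_inter, Finset.sum_const,
      Finset.sum_const, Finset.card_univ, ← Nat.card_eq_fintype_card, smul_eq_mul, smul_eq_mul]
    ring
  rw [← hdc] at hup
  have hA : 0 < Nat.card A := Nat.card_pos
  refine Nat.le_of_mul_le_mul_left ?_ hA
  nlinarith

theorem index_stabilizer_mul_le [Finite A] (g h : G) :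
    (MulAction.stabilizer A (g * h)).index ≤
      (MulAction.stabilizer A g).index * (MulAction.stabilizer A h).index := by
  refine le_trans (Nat.le_of_dvd (Nat.pos_of_ne_zero Subgroup.index_ne_zero_of_finite)
    (Subgroup.index_dvd_of_le ?_)) Subgroup.index_inf_le
  rintro a ⟨h1, h2⟩
  have h1' : a • g = g := h1
  have h2' : a • h = h := h2
  rw [MulAction.mem_stabilizer_iff, smul_mul', h1', h2']

theorem index_stabilizer_inv (g : G) :
    (MulAction.stabilizer A g⁻¹).index = (MulAction.stabilizer A g).index := by
  congr 1
  ext a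
  simp [MulAction.mem_stabilizer_iff, smul_inv']

/-- If point centralizers of elements of `A` have index at most `m`, then a subgroup of bounded
index consists of elements with `A`-orbits of bounded size. -/
theorem exists_subgroup_index_stabilizer_le [Finite A] [Finite G] {m : ℕ} (hm0 : 0 < m)
    (hm : ∀ a : A, (elemCentralizer (G := G) a).index ≤ m) :
    ∃ E : Subgroup G, E.index ≤ 2 * m ∧
      ∀ g ∈ E, (MulAction.stabilizer A g).index ≤ (2 * m) ^ 2 ^ (6 * m + 1) := by
  have hpos : 0 < 2 * m := by omega
  have hmono : Monotone fun n : ℕ => (2 * m) ^ 2 ^ n := fun i j hij =>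
    Nat.pow_le_pow_right hpos (Nat.pow_le_pow_right two_pos hij)
  let X : ℕ → Set G := fun n => {g | (MulAction.stabilizer A g).index ≤ (2 * m) ^ 2 ^ n}
  have hXmono : Monotone X := fun i j hij g hg => le_trans hg (hmono hij)
  have hX0 : Nat.card G ≤ 2 * m * (X 0).ncard := by
    simpa [X] using card_le_mul_ncard_index_stabilizer_le hm
  obtain ⟨n, hn, E, hE⟩ := Subgroup.exists_coe_eq_of_mul_subset X hXmono
    (by
      have : MulAction.stabilizer A (1 : G) = ⊤ := by ext; simp
      simp only [X, Set.mem_ofPred_eq, this, Subgroup.index_top]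
      exact Nat.one_le_pow _ _ hpos)
    (fun n x hx => by simpa [X, index_stabilizer_inv] using hx)
    (fun n x hx y hy => by
      refine (index_stabilizer_mul_le x y).trans ((Nat.mul_le_mul hx hy).trans (le_of_eq ?_))
      rw [pow_succ 2 n, pow_mul, sq]) (2 * m) hX0
  refine ⟨E, ?_, fun g hg => ?_⟩
  · have h1 : (X 0).ncard ≤ Nat.card E := by
      rw [← SetLike.coe_sort_coe, Nat.card_coe_set_eq, hE]
      exact Set.ncard_le_ncard (hXmono (Nat.zero_le n)) (Set.toFinite _)
    refine Nat.le_of_mul_le_mul_right ?_ (Nat.card_pos (α := E))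
    rw [E.index_mul_card]
    exact hX0.trans (Nat.mul_le_mul_left _ h1)
  · rw [← SetLike.mem_coe, hE] at hg
    exact le_trans hg (hmono (by omega))

theorem exists_subgroups_forall_smul_eq [Finite A] [Finite G]
    (hco : (Nat.card A).Coprime (Nat.card G)) {m N : ℕ} (hm0 : 0 < m)
    (hm : ∀ a : A, (elemCentralizer (G := G) a).index ≤ m) (E : Subgroup G)
    (hE : ∀ g ∈ E, (MulAction.stabilizer A g).index ≤ N) :
    ∃ (K : Subgroup A) (C : Subgroup G), K.index ≤ N ^ N ∧ C.index ≤ E.index * m ^ N ∧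
      ∀ k ∈ K, ∀ c ∈ C, k • c = c := by
  classical
  obtain ⟨⟨v, hvE⟩, hv⟩ := Finite.exists_max fun g : E => (MulAction.stabilizer A (g : G)).index
  simp only [Subtype.forall] at hv
  have hN0 : 0 < N := by
    have h1 := hE v hvE
    have h2 := (MulAction.stabilizer A v).index_ne_zero_of_finite
    omega
  let O := MulAction.orbit A v
  have := Fintype.ofFinite O
  have hO : Fintype.card O ≤ N := by
    rw [← Nat.card_eq_fintype_card, Nat.card_coe_set_eq, ← MulAction.index_stabilizer]
    exact hE v hvE
  have hOstab : ∀ x : O, (MulAction.stabilizer A (x : G)).index ≤ N := by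
    rintro ⟨x, hx⟩
    rw [MulAction.index_stabilizer, MulAction.orbit_eq_iff.2 hx, ← MulAction.index_stabilizer]
    exact hE v hvE
  choose t ht using fun x : O => x.2
  refine ⟨⨅ x : O, MulAction.stabilizer A (x : G), E ⊓ ⨅ x : O, elemCentralizer (t x), ?_, ?_, ?_⟩
  · refine (Subgroup.index_iInf_le _).trans ?_
    refine (Finset.prod_le_prod' fun x _ => hOstab x).trans ?_
    rw [Finset.prod_const, Finset.card_univ]
    exact Nat.pow_le_pow_right hN0 hO
  · refine Subgroup.index_inf_le.trans (Nat.mul_le_mul_left _ ?_)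
    refine (Subgroup.index_iInf_le _).trans ?_
    refine (Finset.prod_le_prod' fun x _ => hm (t x)).trans ?_
    rw [Finset.prod_const, Finset.card_univ]
    exact Nat.pow_le_pow_right hm0 hO
  · rintro k hk u ⟨huE, hu⟩
    simp only [Subgroup.mem_iInf, MulAction.mem_stabilizer_iff] at hk
    replace hu : ∀ x : O, t x • u = u := Subgroup.mem_iInf.1 hu
    have hsub : u • O ⊆ MulAction.orbit A (u * v) := by
      rintro _ ⟨x, hx, rfl⟩
      refine ⟨t ⟨x, hx⟩, ?_⟩
      have h : t ⟨x, hx⟩ • v = x := ht ⟨x, hx⟩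
      simp only [smul_mul', hu, h, smul_eq_mul]
    have heq : u • O = MulAction.orbit A (u * v) := by
      refine Set.eq_of_subset_of_ncard_le hsub ?_ (Set.toFinite _)
      rw [Set.ncard_smul_set, ← MulAction.index_stabilizer, ← MulAction.index_stabilizer]
      exact hv _ (E.mul_mem huE hvE)
    obtain ⟨x, hx, hxk⟩ := heq.ge (MulAction.mem_orbit (u * v) k)
    have hkv : k • v = v := hk ⟨v, MulAction.mem_orbit_self v⟩
    have hkx : k • x = x := hk ⟨x, hx⟩
    have hxk' : u * x = k • u * v := by simpa [smul_mul', hkv] using hxk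
    refine smul_eq_self_of_coprime hco (w := x * v⁻¹) ?_ ?_
    · rw [← mul_assoc, hxk', mul_inv_cancel_right]
    · rw [smul_mul', smul_inv', hkx, hkv]

end Action

/-- If a finite group `A` acts coprimely on a finite group `G` with
`|[G,a]| ≤ m` for every `a ∈ A`, then `|[G,A]|` is bounded in terms of `m` alone. -/
theorem stmt_16 (m : ℕ) :
    ∃ C : ℕ, ∀ (A G : Type) (_ : Group A) (_ : Finite A) (_ : Group G) (_ : Finite G)
      (_ : MulDistribMulAction A G),
      Nat.Coprime (Nat.card A) (Nat.card G) →
      (∀ a : A, Nat.card (elemCommutator (G := G) a) ≤ m) →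
      Nat.card (actionCommutator A (G := G)) ≤ C := by
  let N := (2 * m) ^ 2 ^ (6 * m + 1)
  let D := 2 * m * m ^ N
  refine ⟨m ^ (D ^ D * N ^ N), ?_⟩
  intro A G _ _ _ _ _ hco hm
  have hm0 : 0 < m := Nat.card_pos.trans_le (hm 1)
  have hind : ∀ a : A, (elemCentralizer (G := G) a).index ≤ m := fun a =>
    (index_elemCentralizer_le a).trans (hm a)
  obtain ⟨E, hEi, hE⟩ := exists_subgroup_index_stabilizer_le hm0 hind
  obtain ⟨K, C, hK, hC, hKC⟩ := exists_subgroups_forall_smul_eq hco hm0 hind E hE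
  have hCD : C.index ≤ D := hC.trans (Nat.mul_le_mul_right _ hEi)
  have hD0 : 0 < D := by positivity
  have hker : (MulAction.toPermHom K G).ker.index ≤ D ^ D := by
    refine (index_ker_le_of_forall_smul_eq (hco.of_dvd_left K.card_subgroup_dvd_card) C
      fun k c hc => hKC k k.2 c hc).trans ?_
    exact (Nat.pow_le_pow_left hCD _).trans (Nat.pow_le_pow_right hD0 hCD)
  have hle : (MulAction.toPermHom K G).ker.map K.subtype ≤ (MulAction.toPermHom A G).ker := by
    rintro _ ⟨k, hk, rfl⟩
    exact mem_ker_toPermHom.2 (mem_ker_toPermHom.1 hk)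
  refine (card_actionCommutator_le hm).trans (Nat.pow_le_pow_right hm0 ?_)
  refine (Nat.le_of_dvd (Nat.pos_of_ne_zero Subgroup.index_ne_zero_of_finite)
    (Subgroup.index_dvd_of_le hle)).trans ?_
  rw [Subgroup.index_map_subtype]
  exact Nat.mul_le_mul hker hK
end
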